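/- Higher-moment increment bound used in the Kolmogorov continuity test (proof of Proposition 5.1): for every integer q ≥ 1 there exists a constant C = C(q) > 0 with the following property. Let H be a real separable Hilbert space, h > 0, N ∈ ℕ, and (M_n)_{0≤n≤N} an H-valued discrete-parameter martingale with respect to a filtration (F_n) such that E[‖M_n‖^{2q}] < ∞ for all n and E[‖M_{k+1} − M_k‖^{2q}] ≤ K h^q for every 0 ≤ k ≤ N−1, where K ≥ 0. Then for all 0 ≤ n ≤ n' ≤ N, E[ max_{n≤k≤n'} ‖M_k − M_n‖^{2q} ] ≤ C K (n' − n)^q h^q. -/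

import Mathlib

open MeasureTheory

lemma kib_mix1 (r : ℕ) (a s : ℝ) (ha : 0 ≤ a) (hs : 0 ≤ s) :
    a ^ r * s ^ 2 ≤ a ^ (r + 1) * s + s ^ (r + 2) := by
  rcases le_total s a with h | h
  · have : a ^ r * s ^ 2 ≤ a ^ (r + 1) * s := by
      have : 0 ≤ a ^ r * s * (a - s) := by
        have := sub_nonneg.2 h
        positivity
      ring_nf at this ⊢; linarith
    have : 0 ≤ s ^ (r + 2) := by positivity
    linarith
  · have h1 : a ^ r * s ^ 2 ≤ s ^ r * s ^ 2 := by gcongr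
    have : 0 ≤ a ^ (r + 1) * s := by positivity
    rw [pow_add s]; linarith

lemma kib_mix2 (r : ℕ) (a s : ℝ) (ha : 0 ≤ a) (hs : 0 ≤ s) :
    a * s ^ (r + 1) ≤ a ^ (r + 1) * s + s ^ (r + 2) := by
  rcases le_total s a with h | h
  · have h1 : a * s * s ^ r ≤ a * s * a ^ r := by gcongr
    have : 0 ≤ s ^ (r + 2) := by positivity
    ring_nf at h1 this ⊢; linarith
  · have h1 : a * s ^ (r + 1) ≤ s * s ^ (r + 1) := by gcongr
    have : 0 ≤ a ^ (r + 1) * s := by positivity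
    ring_nf at h1 this ⊢; linarith

/-- `u^n v ≤ u^(n+1) + v^(n+1)`. -/
lemma kib_young (n : ℕ) (u v : ℝ) (hu : 0 ≤ u) (hv : 0 ≤ v) :
    u ^ n * v ≤ u ^ (n + 1) + v ^ (n + 1) := by
  rcases le_total v u with h | h
  · have h1 : u ^ n * v ≤ u ^ n * u := by gcongr
    have : 0 ≤ v ^ (n + 1) := by positivity
    rw [pow_succ u]; linarith
  · have h1 : u ^ n * v ≤ v ^ n * v := by gcongr
    have : 0 ≤ u ^ (n + 1) := by positivity
    rw [pow_succ v]; linarith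

lemma kib_taylor (r : ℕ) : ∃ c : ℝ, 0 ≤ c ∧ ∀ a s t : ℝ, 0 ≤ a → 0 ≤ s → t ^ 2 ≤ a * s →
    (a + 2 * t + s) ^ (r + 1) ≤
      a ^ (r + 1) + 2 * (r + 1) * (a ^ r * t) + c * (a ^ r * s + s ^ (r + 1)) := by
  induction r with
  | zero =>
    refine ⟨1, zero_le_one, fun a s t ha hs _ => ?_⟩
    norm_num; linarith
  | succ r ih =>
    obtain ⟨c, hc, H⟩ := ih
    refine ⟨8 * c + 8 * (r + 1) + 1, by positivity, fun a s t ha hs ht => ?_⟩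
    have H1 := H a s t ha hs ht
    have habs : 2 * |t| ≤ a + s := by
      have : |t| ^ 2 ≤ ((a + s) / 2) ^ 2 := by
        rw [sq_abs]; nlinarith [sq_nonneg (a - s)]
      have := (pow_le_pow_iff_left₀ (abs_nonneg t) (by positivity) two_ne_zero).1 this
      linarith
    have ht1 : 2 * t ≤ a + s := by linarith [le_abs_self t]
    have hpos : 0 ≤ a + 2 * t + s := by linarith [neg_abs_le t]
    have m1 := kib_mix1 r a s ha hs
    have m2 := kib_mix2 r a s ha hs
    have hY : 0 ≤ s ^ (r + 2) := by positivity
    have hX : 0 ≤ a ^ (r + 1) * s := by positivity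
    have hstep := mul_le_mul_of_nonneg_left H1 hpos
    have e0 : (a + 2 * t + s) ^ (r + 1 + 1) = (a + 2 * t + s) * (a + 2 * t + s) ^ (r + 1) := by ring
    rw [e0]
    refine hstep.trans ?_
    have k1 : 4 * ((r : ℝ) + 1) * a ^ r * t ^ 2 ≤ 4 * ((r : ℝ) + 1) * a ^ r * (a * s) := by gcongr
    have k2 : c * (a ^ r * s + s ^ (r + 1)) * (2 * t) ≤ c * (a ^ r * s + s ^ (r + 1)) * (a + s) := by
      gcongr
    have k3 : (r + 1) * (a ^ r * s) * (2 * t) ≤ (r + 1) * (a ^ r * s) * (a + s) := by gcongr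
    have k4 := mul_le_mul_of_nonneg_left m1 hc
    have k5 := mul_le_mul_of_nonneg_left m2 hc
    have k6 := mul_le_mul_of_nonneg_left m1 (show (0:ℝ) ≤ r + 1 by positivity)
    have k7 := mul_nonneg hc hX
    have k8 := mul_nonneg hc hY
    have k9 := mul_nonneg (show (0:ℝ) ≤ r + 1 by positivity) hX
    have k10 := mul_nonneg (show (0:ℝ) ≤ r + 1 by positivity) hY
    push_cast
    ring_nf at k1 k2 k3 k4 k5 k6 k7 k8 k9 k10 hX hY ⊢
    nlinarith

/-- Azema-Yor step. -/
lemma kib_ay (n : ℕ) (m f f' : ℝ) (hm : 0 ≤ m) (hf : 0 ≤ f') :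
    (n : ℝ) * (max m f') ^ (n + 1) - (n + 1) * ((max m f') ^ n * f') ≤
      n * m ^ (n + 1) - (n + 1) * (m ^ n * f) - (n + 1) * (m ^ n * (f' - f)) := by
  rcases le_total f' m with h | h
  · rw [max_eq_left h]; apply le_of_eq; ring
  · rw [max_eq_right h]
    have : ((n : ℝ) + 1) * (m ^ n * f') ≤ n * m ^ (n + 1) + f' ^ (n + 1) := by
      clear h f
      induction n with
      | zero => simp
      | succ n ih =>
        have h1 := mul_le_mul_of_nonneg_left ih hm
        have h2 : 0 ≤ (f' ^ (n + 1) - m ^ (n + 1)) * (f' - m) := by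
          rcases le_total f' m with h | h
          · have := pow_le_pow_left₀ hf h (n + 1)
            exact mul_nonneg_of_nonpos_of_nonpos (by linarith) (by linarith)
          · have := pow_le_pow_left₀ hm h (n + 1)
            exact mul_nonneg (by linarith) (by linarith)
        push_cast
        ring_nf at h1 h2 ⊢
        nlinarith
    ring_nf at this ⊢
    linarith

lemma kib_absorb (n : ℕ) (m f : ℝ) (hm : 0 ≤ m) (hf : 0 ≤ f) :
    ((n : ℝ) + 1) * (m ^ n * f) ≤ 1 / 2 * m ^ (n + 1) +
      (n + 1) * (2 * (n + 1)) ^ n * f ^ (n + 1) := by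
  rcases le_total (2 * (n + 1) * f) m with h | h
  · have h1 : m ^ n * (2 * (n + 1) * f) ≤ m ^ n * m := by gcongr
    have : 0 ≤ ((n:ℝ) + 1) * (2 * (n + 1)) ^ n * f ^ (n + 1) := by positivity
    rw [pow_succ m]; linarith
  · have h1 : m ^ n ≤ (2 * (n + 1) * f) ^ n := by gcongr
    have h2 : ((n : ℝ) + 1) * (m ^ n * f) ≤ (n + 1) * ((2 * (n + 1) * f) ^ n * f) := by gcongr
    have : 0 ≤ 1 / 2 * m ^ (n + 1) := by positivity
    rw [mul_pow] at h2
    rw [pow_succ f]; linarith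

lemma kib_wyoung (r : ℕ) (a s l : ℝ) (ha : 0 ≤ a) (hs : 0 ≤ s) (hl : 0 < l) :
    a ^ r * s ≤ l⁻¹ * a ^ (r + 1) + l ^ r * s ^ (r + 1) := by
  have h := kib_young r (a / l) s (by positivity) hs
  have h1 := mul_le_mul_of_nonneg_left h (show 0 ≤ l ^ r by positivity)
  have e1 : l ^ r * ((a / l) ^ r * s) = a ^ r * s := by
    rw [div_pow]; field_simp
  have e2 : l ^ r * ((a / l) ^ (r + 1) + s ^ (r + 1)) =
      l⁻¹ * a ^ (r + 1) + l ^ r * s ^ (r + 1) := by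
    rw [div_pow]; field_simp; ring
  rwa [e1, e2] at h1

/-- Martingale increments are orthogonal to the past. -/
lemma kib_orth {H : Type} [NormedAddCommGroup H] [InnerProductSpace ℝ H] [CompleteSpace H]
    {Ω : Type} {mΩ : MeasurableSpace Ω} {μ : Measure Ω} [IsProbabilityMeasure μ]
    {ℱ : Filtration ℕ mΩ} {M : ℕ → Ω → H} (hM : Martingale M ℱ μ) (k n : ℕ)
    (V : Ω → H) (hV : StronglyMeasurable[ℱ k] V) (u : Ω → ℝ) (hu : ∀ ω, 0 ≤ u ω)
    (hVu : ∀ ω, ‖V ω‖ ≤ u ω ^ n) (hui : Integrable (fun ω => u ω ^ (n + 1)) μ)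
    (hd : Integrable (fun ω => ‖M (k + 1) ω - M k ω‖ ^ (n + 1)) μ) :
    Integrable (fun ω => inner ℝ (V ω) (M (k + 1) ω - M k ω)) μ ∧
      ∫ ω, inner ℝ (V ω) (M (k + 1) ω - M k ω) ∂μ = 0 := by
  have hdi : Integrable (fun ω => M (k + 1) ω - M k ω) μ :=
    (hM.integrable (k + 1)).sub (hM.integrable k)
  have hint : Integrable (fun ω => inner ℝ (V ω) (M (k + 1) ω - M k ω)) μ := by
    refine (hui.add hd).mono' ?_ (Filter.Eventually.of_forall fun ω => ?_)
    · exact (hV.mono (ℱ.le k)).aestronglyMeasurable.inner hdi.aestronglyMeasurable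
    · refine (norm_inner_le_norm _ _).trans ?_
      refine le_trans ?_ (kib_young n (u ω) ‖M (k + 1) ω - M k ω‖ (hu ω) (norm_nonneg _))
      gcongr
      exact hVu ω
  refine ⟨hint, ?_⟩
  have hc := condExp_bilin_of_stronglyMeasurable_left (m := ℱ k) (innerSL ℝ (E := H)) hV
    (g := fun ω => M (k + 1) ω - M k ω) hint hdi
  have hz : μ[fun ω => M (k + 1) ω - M k ω | ℱ k] =ᵐ[μ] 0 := by
    have h1 := condExp_sub (hM.integrable (k + 1)) (hM.integrable k) (ℱ k)
    have h2 := hM.2 k (k + 1) (Nat.le_succ k)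
    have h3 := hM.2 k k le_rfl
    refine Filter.EventuallyEq.trans h1 ?_
    filter_upwards [h2, h3] with ω e2 e3
    simp [e2, e3]
  have h0 : (∫ ω, (μ[fun ω => innerSL ℝ (V ω) (M (k + 1) ω - M k ω) | ℱ k]) ω ∂μ) = 0 := by
    rw [integral_congr_ae hc]
    refine integral_eq_zero_of_ae ?_
    filter_upwards [hz] with ω e
    simp [e]
  rw [integral_condExp (ℱ.le k)] at h0
  simpa using h0

/-- Running maximum. -/
noncomputable def kibMax {Ω : Type} (f : ℕ → Ω → ℝ) : ℕ → Ω → ℝ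
  | 0 => fun _ => 0
  | k + 1 => fun ω => max (kibMax f k ω) (f (k + 1) ω)

lemma kibMax_nonneg {Ω : Type} (f : ℕ → Ω → ℝ) (k : ℕ) (ω : Ω) : 0 ≤ kibMax f k ω := by
  induction k with
  | zero => exact le_rfl
  | succ k ih => exact le_max_of_le_left ih

lemma kibMax_le {Ω : Type} (f : ℕ → Ω → ℝ) (ω : Ω) (h0 : f 0 ω ≤ 0) (k j : ℕ) (hj : j ≤ k) :
    f j ω ≤ kibMax f k ω := by
  induction k with
  | zero => obtain rfl : j = 0 := by omega
            exact h0
  | succ k ih =>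
    rcases Nat.lt_or_ge j (k + 1) with h | h
    · exact le_max_of_le_left (ih (by omega))
    · obtain rfl : j = k + 1 := by omega
      exact le_max_right _ _

section
variable {H : Type} [NormedAddCommGroup H] [InnerProductSpace ℝ H] [CompleteSpace H]
    {Ω : Type} {mΩ : MeasurableSpace Ω} {μ : Measure Ω} [IsProbabilityMeasure μ]
    {ℱ : Filtration ℕ mΩ} {M : ℕ → Ω → H}

lemma kib_int_sub (hM : Martingale M ℱ μ) (i j p : ℕ)
    (hi : Integrable (fun ω => ‖M i ω‖ ^ p) μ) (hj : Integrable (fun ω => ‖M j ω‖ ^ p) μ) :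
    Integrable (fun ω => ‖M i ω - M j ω‖ ^ p) μ := by
  refine ((hi.add hj).const_mul (2 ^ (p - 1))).mono' ?_ (Filter.Eventually.of_forall fun ω => ?_)
  · exact ((hM.integrable i).sub (hM.integrable j)).aestronglyMeasurable.norm.pow p
  · rw [Real.norm_of_nonneg (by positivity)]
    refine (pow_le_pow_left₀ (norm_nonneg _) (norm_sub_le _ _) p).trans ?_
    exact add_pow_le (norm_nonneg _) (norm_nonneg _) p

lemma kib_meas (hM : Martingale M ℱ μ) (n k : ℕ) :
    StronglyMeasurable[ℱ (n + k)] (fun ω => M (n + k) ω - M n ω) :=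
  (hM.1 (n + k)).sub ((hM.1 n).mono (ℱ.mono (Nat.le_add_right n k)))

lemma kib_max_meas (hM : Martingale M ℱ μ) (n k : ℕ) :
    StronglyMeasurable[ℱ (n + k)] (kibMax (fun k ω => ‖M (n + k) ω - M n ω‖) k) := by
  induction k with
  | zero => exact stronglyMeasurable_const
  | succ k ih =>
    exact continuous_max.comp_stronglyMeasurable
      ((ih.mono (ℱ.mono (by omega))).prodMk (kib_meas hM n (k + 1)).norm)

lemma kib_max_int (hM : Martingale M ℱ μ) (n m p : ℕ) (hp : p ≠ 0)
    (hi : ∀ j ≤ n + m, Integrable (fun ω => ‖M j ω‖ ^ p) μ) (k : ℕ) (hk : k ≤ m) :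
    Integrable (fun ω => kibMax (fun k ω => ‖M (n + k) ω - M n ω‖) k ω ^ p) μ := by
  induction k with
  | zero => simp [kibMax, hp]
  | succ k ih =>
    have h2 := kib_int_sub hM (n + (k + 1)) n p (hi _ (by omega)) (hi _ (by omega))
    refine ((ih (by omega)).add h2).mono' ?_ (Filter.Eventually.of_forall fun ω => ?_)
    · exact (((kib_max_meas hM n (k + 1)).mono (ℱ.le _)).pow p).aestronglyMeasurable
    · have h0 := kibMax_nonneg (fun k ω => ‖M (n + k) ω - M n ω‖) k ω
      rw [Real.norm_of_nonneg (pow_nonneg (kibMax_nonneg _ _ _) p)]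
      simp only [kibMax, Pi.add_apply]
      rcases le_total (kibMax (fun k ω => ‖M (n + k) ω - M n ω‖) k ω)
        ‖M (n + (k + 1)) ω - M n ω‖ with h | h
      · rw [max_eq_right h]
        exact le_add_of_nonneg_left (by positivity)
      · rw [max_eq_left h]
        exact le_add_of_nonneg_right (by positivity)

/-- Terminal moment bound. -/
lemma kib_terminal (r : ℕ) (c : ℝ) (hc : 0 ≤ c)
    (hT : ∀ a s t : ℝ, 0 ≤ a → 0 ≤ s → t ^ 2 ≤ a * s →
    (a + 2 * t + s) ^ (r + 1) ≤
      a ^ (r + 1) + 2 * (r + 1) * (a ^ r * t) + c * (a ^ r * s + s ^ (r + 1)))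
    (hM : Martingale M ℱ μ) (n m : ℕ) (A : ℝ) (hA : 0 ≤ A)
    (hi : ∀ j ≤ n + m, Integrable (fun ω => ‖M j ω‖ ^ (2 * (r + 1))) μ)
    (hd : ∀ k < n + m, ∫ ω, ‖M (k + 1) ω - M k ω‖ ^ (2 * (r + 1)) ∂μ ≤ A)
    (k : ℕ) (hk : k ≤ m) :
    ∫ ω, ‖M (n + k) ω - M n ω‖ ^ (2 * (r + 1)) ∂μ ≤ (3 * c + 1) ^ (r + 1) * k ^ (r + 1) * A := by
  induction k with
  | zero => simp
  | succ k ih =>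
    have ih := ih (by omega)
    set b : ℝ := 3 * c + 1 with hb
    have hbpos : 0 < b := by positivity
    set l : ℝ := b * (k + 1) with hl
    have hlpos : 0 < l := by positivity
    have iS := kib_int_sub hM (n + k) n _ (hi _ (by omega)) (hi _ (by omega))
    have iS' := kib_int_sub hM (n + (k + 1)) n _ (hi _ (by omega)) (hi _ (by omega))
    have iD := kib_int_sub hM (n + k + 1) (n + k) _ (hi _ (by omega)) (hi _ (by omega))
    have hDA := hd (n + k) (by omega)
    obtain ⟨iV, hV⟩ := kib_orth hM (n + k) (2 * r + 1)
      (fun ω => (‖M (n + k) ω - M n ω‖ ^ 2) ^ r • (M (n + k) ω - M n ω))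
      (((kib_meas hM n k).norm.pow 2 |>.pow r).smul (kib_meas hM n k))
      (fun ω => ‖M (n + k) ω - M n ω‖) (fun ω => norm_nonneg _)
      (fun ω => by
        rw [norm_smul, Real.norm_of_nonneg (by positivity), ← pow_mul, pow_succ])
      iS iD
    have hpt : ∀ ω, ‖M (n + (k + 1)) ω - M n ω‖ ^ (2 * (r + 1)) ≤
        (1 + c * l⁻¹) * ‖M (n + k) ω - M n ω‖ ^ (2 * (r + 1)) +
        2 * (r + 1) * inner ℝ ((‖M (n + k) ω - M n ω‖ ^ 2) ^ r • (M (n + k) ω - M n ω))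
          (M (n + k + 1) ω - M (n + k) ω) +
        c * (l ^ r + 1) * ‖M (n + k + 1) ω - M (n + k) ω‖ ^ (2 * (r + 1)) := by
      intro ω
      have e : M (n + (k + 1)) ω - M n ω =
        (M (n + k) ω - M n ω) + (M (n + k + 1) ω - M (n + k) ω) := by
        rw [← add_assoc]; abel
      rw [e]
      generalize M (n + k) ω - M n ω = x
      generalize M (n + k + 1) ω - M (n + k) ω = y
      rw [pow_mul, pow_mul, pow_mul, norm_add_sq_real, real_inner_smul_left]
      have t1 := hT (‖x‖ ^ 2) (‖y‖ ^ 2) (inner ℝ x y) (by positivity) (by positivity) (by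
        rw [← mul_pow, ← sq_abs]
        exact pow_le_pow_left₀ (abs_nonneg _) (abs_real_inner_le_norm x y) 2)
      have t2 := mul_le_mul_of_nonneg_left
        (kib_wyoung r (‖x‖ ^ 2) (‖y‖ ^ 2) l (by positivity) (by positivity) hlpos) hc
      linarith
    have hmono := integral_mono iS' (((iS.const_mul (1 + c * l⁻¹)).add
      (iV.const_mul (2 * ((r : ℝ) + 1)))).add (iD.const_mul (c * (l ^ r + 1)))) hpt
    rw [integral_add' ((iS.const_mul (1 + c * l⁻¹)).add
      (iV.const_mul (2 * ((r : ℝ) + 1)))) (iD.const_mul (c * (l ^ r + 1))),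
      integral_add' (iS.const_mul (1 + c * l⁻¹)) (iV.const_mul (2 * ((r : ℝ) + 1))),
      integral_const_mul, integral_const_mul, integral_const_mul, hV, mul_zero, add_zero] at hmono
    refine hmono.trans ?_
    have h1 : (1 + c * l⁻¹) * ∫ ω, ‖M (n + k) ω - M n ω‖ ^ (2 * (r + 1)) ∂μ ≤
      (1 + c * l⁻¹) * (b ^ (r + 1) * k ^ (r + 1) * A) := by gcongr
    have h2 : c * (l ^ r + 1) * ∫ ω, ‖M (n + k + 1) ω - M (n + k) ω‖ ^ (2 * (r + 1)) ∂μ ≤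
      c * (l ^ r + 1) * A := by gcongr
    have hl1 : 1 ≤ l := by
      rw [hl]; nlinarith [(Nat.cast_nonneg k : (0:ℝ) ≤ k)]
    have h3 : (1:ℝ) ≤ l ^ r := one_le_pow₀ hl1
    have h4 : b * k ≤ l := by rw [hl]; nlinarith
    have h5 : l⁻¹ * (b ^ (r + 1) * k ^ (r + 1)) ≤ l ^ r := by
      rw [← mul_pow]
      calc l⁻¹ * (b * k) ^ (r + 1) ≤ l⁻¹ * l ^ (r + 1) := by gcongr
        _ = l ^ r := by rw [pow_succ]; field_simp
    have h6 : b ^ (r + 1) * k ^ (r + 1) ≤ l ^ r * (b * k) := by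
      rw [← mul_pow, pow_succ]
      gcongr
    have h7 : (b ^ (r + 1) * ((k + 1 : ℕ) : ℝ) ^ (r + 1)) = l ^ r * (b * k) + b * l ^ r := by
      rw [← mul_pow, hl]; push_cast; ring
    rw [h7]
    have h8 : (1 + c * l⁻¹) * (b ^ (r + 1) * k ^ (r + 1)) + c * (l ^ r + 1) ≤
      l ^ r * (b * k) + b * l ^ r := by
      have g1 := mul_le_mul_of_nonneg_left h5 hc
      have g2 := mul_le_mul_of_nonneg_left h3 hc
      have : b * l ^ r = 3 * (c * l ^ r) + l ^ r := by rw [hb]; ring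
      rw [this]
      linarith
    have h9 := mul_le_mul_of_nonneg_right h8 hA
    linarith

/-- Maximal inequality via the Azema-Yor process. -/
lemma kib_doob (q : ℕ) (hM : Martingale M ℱ μ) (n m : ℕ)
    (hi : ∀ j ≤ n + m, Integrable (fun ω => ‖M j ω‖ ^ (q + 1 + 1)) μ)
    (k : ℕ) (hk : k ≤ m) :
    Integrable (fun ω => kibMax (fun k ω => ‖M (n + k) ω - M n ω‖) k ω ^ (q + 1)
        * ‖M (n + k) ω - M n ω‖) μ ∧
    ((q + 1 : ℕ) : ℝ) * ∫ ω, kibMax (fun k ω => ‖M (n + k) ω - M n ω‖) k ω ^ (q + 1 + 1) ∂μ ≤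
      (((q + 1 : ℕ) : ℝ) + 1) * ∫ ω, kibMax (fun k ω => ‖M (n + k) ω - M n ω‖) k ω ^ (q + 1)
        * ‖M (n + k) ω - M n ω‖ ∂μ := by
  set f : ℕ → Ω → ℝ := fun k ω => ‖M (n + k) ω - M n ω‖ with hf
  have hmul : ∀ k ≤ m, Integrable (fun ω => kibMax f k ω ^ (q + 1) * f k ω) μ := by
    intro k hk
    have i1 := kib_max_int hM n m (q + 1 + 1) (by omega) hi k hk
    have i2 := kib_int_sub hM (n + k) n _ (hi _ (by omega)) (hi _ (by omega))
    refine (i1.add i2).mono' ?_ (Filter.Eventually.of_forall fun ω => ?_)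
    · exact ((((kib_max_meas hM n k).pow (q + 1)).mul (kib_meas hM n k).norm).mono
        (ℱ.le _)).aestronglyMeasurable
    · have h0 := kibMax_nonneg f k ω
      have h1 : 0 ≤ f k ω := norm_nonneg _
      rw [Real.norm_of_nonneg (by positivity)]
      exact kib_young (q + 1) _ _ h0 h1
  refine ⟨hmul k hk, ?_⟩
  induction k with
  | zero => simp [kibMax]
  | succ k ih =>
    have ih := ih (by omega)
    have iX := kib_max_int hM n m (q + 1 + 1) (by omega) hi k (by omega)
    have iX' := kib_max_int hM n m (q + 1 + 1) (by omega) hi (k + 1) (by omega)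
    have iP := hmul k (by omega)
    have iP' := hmul (k + 1) (by omega)
    have iD := kib_int_sub hM (n + k + 1) (n + k) _ (hi _ (by omega)) (hi _ (by omega))
    obtain ⟨iV, hV⟩ := kib_orth hM (n + k) (q + 1)
      (fun ω => kibMax f k ω ^ (q + 1) • (‖M (n + k) ω - M n ω‖⁻¹ • (M (n + k) ω - M n ω)))
      (((kib_max_meas hM n k).pow (q + 1)).smul
        (((kib_meas hM n k).norm.measurable.inv.stronglyMeasurable).smul (kib_meas hM n k)))
      (fun ω => kibMax f k ω) (fun ω => kibMax_nonneg f k ω)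
      (fun ω => by
        have h0 := kibMax_nonneg f k ω
        rw [norm_smul, Real.norm_of_nonneg (by positivity), norm_smul, norm_inv, norm_norm]
        refine mul_le_of_le_one_right (by positivity) ?_
        exact inv_mul_le_one)
      iX iD
    have hpt : ∀ ω, ((q + 1 : ℕ) : ℝ) * kibMax f (k + 1) ω ^ (q + 1 + 1) +
        (((q + 1 : ℕ) : ℝ) + 1) * (kibMax f k ω ^ (q + 1) * f k ω) +
        (((q + 1 : ℕ) : ℝ) + 1) * inner ℝ
          (kibMax f k ω ^ (q + 1) • (‖M (n + k) ω - M n ω‖⁻¹ • (M (n + k) ω - M n ω)))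
          (M (n + k + 1) ω - M (n + k) ω) ≤
        ((q + 1 : ℕ) : ℝ) * kibMax f k ω ^ (q + 1 + 1) +
        (((q + 1 : ℕ) : ℝ) + 1) * (kibMax f (k + 1) ω ^ (q + 1) * f (k + 1) ω) := by
      intro ω
      have h0 := kibMax_nonneg f k ω
      have t := kib_ay (q + 1) (kibMax f k ω) (f k ω) (f (k + 1) ω) h0 (norm_nonneg _)
      have e : M (n + (k + 1)) ω - M n ω =
        (M (n + k) ω - M n ω) + (M (n + k + 1) ω - M (n + k) ω) := by
        rw [← add_assoc]; abel
      have conv : inner ℝ (‖M (n + k) ω - M n ω‖⁻¹ • (M (n + k) ω - M n ω))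
          (M (n + k + 1) ω - M (n + k) ω) ≤ f (k + 1) ω - f k ω := by
        simp only [hf]
        rw [e]
        generalize M (n + k) ω - M n ω = x
        generalize M (n + k + 1) ω - M (n + k) ω = y
        rw [real_inner_smul_left]
        by_cases hx : x = 0
        · simp [hx]
        have hx' : 0 < ‖x‖ := norm_pos_iff.2 hx
        have h1 := real_inner_le_norm x (x + y)
        rw [inner_add_right, real_inner_self_eq_norm_sq] at h1
        rw [inv_mul_le_iff₀ hx']
        linarith
      have t2 := mul_le_mul_of_nonneg_left conv (show 0 ≤ kibMax f k ω ^ (q + 1) by positivity)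
      have t3 := mul_le_mul_of_nonneg_left t2 (show 0 ≤ ((q + 1 : ℕ) : ℝ) + 1 by positivity)
      rw [real_inner_smul_left]
      have : kibMax f (k + 1) ω = max (kibMax f k ω) (f (k + 1) ω) := rfl
      rw [this]
      linarith
    have j1 := (iX'.const_mul ((q + 1 : ℕ) : ℝ))
    have j2 := (iP.const_mul (((q + 1 : ℕ) : ℝ) + 1))
    have j3 := (iV.const_mul (((q + 1 : ℕ) : ℝ) + 1))
    have j4 := (iX.const_mul ((q + 1 : ℕ) : ℝ))
    have j5 := (iP'.const_mul (((q + 1 : ℕ) : ℝ) + 1))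
    have hmono := integral_mono ((j1.add j2).add j3) (j4.add j5) hpt
    rw [integral_add' (j1.add j2) j3, integral_add' j1 j2, integral_add' j4 j5] at hmono
    simp only [integral_const_mul] at hmono
    rw [hV] at hmono
    linarith

lemma kib_doob' (q : ℕ) (hM : Martingale M ℱ μ) (n m : ℕ)
    (hi : ∀ j ≤ n + m, Integrable (fun ω => ‖M j ω‖ ^ (q + 1 + 1)) μ) :
    ∫ ω, kibMax (fun k ω => ‖M (n + k) ω - M n ω‖) m ω ^ (q + 1 + 1) ∂μ ≤
      2 * ((((q + 1 : ℕ) : ℝ) + 1) * (2 * (((q + 1 : ℕ) : ℝ) + 1)) ^ (q + 1)) *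
        ∫ ω, ‖M (n + m) ω - M n ω‖ ^ (q + 1 + 1) ∂μ := by
  obtain ⟨i1, h1⟩ := kib_doob q hM n m hi m le_rfl
  have iX := kib_max_int hM n m (q + 1 + 1) (by omega) hi m le_rfl
  have iS := kib_int_sub hM (n + m) n _ (hi _ (by omega)) (hi _ (by omega))
  have hmono := integral_mono (i1.const_mul (((q + 1 : ℕ) : ℝ) + 1))
    ((iX.const_mul (1 / 2)).add
      (iS.const_mul ((((q + 1 : ℕ) : ℝ) + 1) * (2 * (((q + 1 : ℕ) : ℝ) + 1)) ^ (q + 1))))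
    (fun ω => kib_absorb (q + 1) _ _ (kibMax_nonneg _ m ω) (norm_nonneg _))
  rw [integral_add' (iX.const_mul (1 / 2)) (iS.const_mul _), integral_const_mul,
    integral_const_mul, integral_const_mul] at hmono
  have hnn : 0 ≤ ∫ ω, kibMax (fun k ω => ‖M (n + k) ω - M n ω‖) m ω ^ (q + 1 + 1) ∂μ :=
    integral_nonneg fun ω => pow_nonneg (kibMax_nonneg _ _ _) _
  have h2 : ∫ ω, kibMax (fun k ω => ‖M (n + k) ω - M n ω‖) m ω ^ (q + 1 + 1) ∂μ ≤
    ((q + 1 : ℕ) : ℝ) * ∫ ω, kibMax (fun k ω => ‖M (n + k) ω - M n ω‖) m ω ^ (q + 1 + 1) ∂μ :=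
    le_mul_of_one_le_left hnn (by push_cast; linarith [(Nat.cast_nonneg q : (0:ℝ) ≤ q)])
  linarith

end

/-- Higher-moment increment bound used in the Kolmogorov continuity test (proof
of Proposition 5.1): for every integer `q ≥ 1` there is `C = C(q) > 0` such that
for every real separable Hilbert space `H`, every `h > 0`, `N`, `K ≥ 0`, and
every `H`-valued martingale `(M_n)_{0≤n≤N}` with `E[‖M_n‖^{2q}] < ∞` for all
`n ≤ N` and `E[‖M_{k+1} − M_k‖^{2q}] ≤ K h^q` for `0 ≤ k ≤ N−1`, one has, for
all `n ≤ n' ≤ N`,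
`E[max_{n≤k≤n'} ‖M_k − M_n‖^{2q}] ≤ C K (n' − n)^q h^q`. -/
theorem kolmogorov_increment_bound (q : ℕ) (hq : 1 ≤ q) :
    ∃ C : ℝ, 0 < C ∧
      ∀ (H : Type) (_ : NormedAddCommGroup H) (_ : InnerProductSpace ℝ H)
        (_ : CompleteSpace H) (_ : TopologicalSpace.SeparableSpace H)
        (Ω : Type) (mΩ : MeasurableSpace Ω) (μ : Measure Ω)
        (_ : IsProbabilityMeasure μ) (ℱ : Filtration ℕ mΩ)
        (h : ℝ) (_ : 0 < h) (N : ℕ) (K : ℝ) (_ : 0 ≤ K) (M : ℕ → Ω → H),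
        Martingale M ℱ μ →
        (∀ n, n ≤ N → Integrable (fun ω => ‖M n ω‖ ^ (2 * q)) μ) →
        (∀ k, k < N →
          (∫ ω, ‖M (k + 1) ω - M k ω‖ ^ (2 * q) ∂μ) ≤ K * h ^ q) →
        ∀ n n' : ℕ, n ≤ n' → n' ≤ N →
          (∫ ω, (⨆ k : Fin (n' - n + 1), ‖M (n + k) ω - M n ω‖ ^ (2 * q)) ∂μ) ≤
            C * K * (n' - n : ℝ) ^ q * h ^ q := by
  obtain ⟨r, rfl⟩ : ∃ r, q = r + 1 := ⟨q - 1, by omega⟩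
  obtain ⟨c, hc, hT⟩ := kib_taylor r
  set D : ℝ := 2 * ((((2 * r + 1 : ℕ) : ℝ) + 1) * (2 * (((2 * r + 1 : ℕ) : ℝ) + 1)) ^ (2 * r + 1))
    with hD
  have hDpos : 0 < D := by positivity
  refine ⟨D * (3 * c + 1) ^ (r + 1), by positivity, ?_⟩
  intro H _ _ _ _ Ω mΩ μ _ ℱ h hh N K hK M hM hi hd n n' hnn hn'
  obtain ⟨m, rfl⟩ := Nat.exists_eq_add_of_le hnn
  have hA : 0 ≤ K * h ^ (r + 1) := by positivity
  have hi' : ∀ j ≤ n + m, Integrable (fun ω => ‖M j ω‖ ^ (2 * (r + 1))) μ :=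
    fun j hj => hi j (hj.trans hn')
  have ht := kib_terminal r c hc hT hM n m (K * h ^ (r + 1)) hA hi'
    (fun k hk => hd k (by omega)) m le_rfl
  have hdb := kib_doob' (2 * r) hM n m hi'
  have hX := kib_max_int hM n m (2 * (r + 1)) (by omega) hi' m le_rfl
  have hsup : (∫ ω, (⨆ k : Fin (n + m - n + 1), ‖M (n + k) ω - M n ω‖ ^ (2 * (r + 1))) ∂μ) ≤
      ∫ ω, kibMax (fun k ω => ‖M (n + k) ω - M n ω‖) m ω ^ (2 * (r + 1)) ∂μ := by
    refine integral_mono_of_nonneg (Filter.Eventually.of_forall fun ω => ?_) hX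
      (Filter.Eventually.of_forall fun ω => ?_)
    · exact Real.iSup_nonneg fun k => by positivity
    · refine ciSup_le fun k => ?_
      refine pow_le_pow_left₀ (norm_nonneg _) ?_ _
      exact kibMax_le (fun k ω => ‖M (n + k) ω - M n ω‖) ω (by simp) m k (by omega)
  refine hsup.trans (hdb.trans ?_)
  have h1 := mul_le_mul_of_nonneg_left ht hDpos.le
  refine h1.trans (le_of_eq ?_)
  push_cast
  ring
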